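/- Let b ≥ 2 be an integer and let x ∈ [0,1) with base-b digits ξ_1, ξ_2, …. Set σ = ∑_{i ≥ 1 : ξ_i ≠ 0} b^{−i}, and if x ≠ 0 let a_1 be the smallest index i with ξ_i ≠ 0. Then ω_2(x) = s_1(x) + s̃_2(x), where s_1(x) = 1 − bσ, and s̃_2(x) = b^{−1} − 2b^{−a_1} − b^{−(a_1+1)} − (a_1 b − a_1 − b)σ if x ≠ 0, while s̃_2(0) = b^{−1}. Moreover, s̃_2(x) equals the (absolutely convergent) sum of r_2(k) wal_k(x) over all integers k ≥ 1 having at least two non-zero base-b digits. -/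

import Mathlib

open scoped BigOperators
open scoped Classical

noncomputable section

/-- The `i`-th base-`b` digit (for `i ≥ 1`) of a real `x` (intended `x ∈ [0,1)`),
using the expansion that does not end in infinitely many digits `b-1`. -/
def xdigit (b : ℕ) (x : ℝ) (i : ℕ) : ℕ := (⌊x * (b : ℝ) ^ i⌋).toNat % b

/-- The `i`-th base-`b` digit of a natural number `k`. -/
def ndigit (b k i : ℕ) : ℕ := k / b ^ i % b

/-- The `k`-th Walsh function in base `b`:
`wal_k(x) = exp(2πi (ξ_1 κ_0 + ξ_2 κ_1 + ⋯)/b)`. -/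
def wal (b k : ℕ) (x : ℝ) : ℂ :=
  Complex.exp (2 * (Real.pi : ℂ) * Complex.I / (b : ℂ) *
    ∑ i ∈ Finset.range (k + 1), (ndigit b k i : ℂ) * (xdigit b x (i + 1) : ℂ))

/-- The set of positions of nonzero base-`b` digits of `k`. -/
def nzset (b k : ℕ) : Finset ℕ :=
  (Finset.range (k + 1)).filter fun i => ndigit b k i ≠ 0

/-- The (at most) `α` largest nonzero-digit positions of `k` in base `b`. -/
def topPos (b α k : ℕ) : Finset ℕ :=
  (nzset b k).filter fun a => ((nzset b k).filter fun y => a < y).card < α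

/-- `r_α(k) = b^{-∑_{i=1}^{min(#k,α)} (a_i + 1)}`, where `a_1 > a_2 > ⋯` are the positions of
the nonzero base-`b` digits of `k`; `r_α(0) = 1`. -/
def ralpha (b α k : ℕ) : ℝ := ((b : ℝ) ^ (∑ a ∈ topPos b α k, (a + 1)))⁻¹

/-- `r_α(γ, k) = ∏_{j : k_j ≠ 0} γ_j r_α(k_j)` (weights indexed from `0`). -/
def rvec (b α : ℕ) (γ : ℕ → ℝ) {s : ℕ} (k : Fin s → ℕ) : ℝ :=
  ∏ j, if k j = 0 then 1 else γ (j : ℕ) * ralpha b α (k j)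

/-- `ω_α(x) = ∑_{k=1}^∞ r_α(k) wal_k(x)`. -/
def omegaF (b α : ℕ) (x : ℝ) : ℂ :=
  ∑' k : ℕ, (ralpha b α (k + 1) : ℂ) * wal b (k + 1) x

/-- `σ(x) = ∑_{i ≥ 1 : ξ_i ≠ 0} b^{-i}`, the sum of `b^{-i}` over the positions of the
nonzero base-`b` digits of `x`. -/
def sigma1 (b : ℕ) (x : ℝ) : ℝ :=
  ∑' i : ℕ, if xdigit b x (i + 1) ≠ 0 then ((b : ℝ) ^ (i + 1))⁻¹ else 0

/-- `σ₂(x) = ∑_{i ≥ 1 : ξ_i ≠ 0} b^{-2i}`. -/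
def sigma2 (b : ℕ) (x : ℝ) : ℝ :=
  ∑' i : ℕ, if xdigit b x (i + 1) ≠ 0 then ((b : ℝ) ^ (2 * (i + 1)))⁻¹ else 0

/-- `s_1(x) = 1 - b σ(x)`. -/
def s1f (b : ℕ) (x : ℝ) : ℝ := 1 - (b : ℝ) * sigma1 b x

/-- `s_2(x) = 1/(b+1) - b(b-2)(σ(x)² - σ₂(x))/2 - b(b-1)(1/(b-1) - σ(x))σ(x)`. -/
def s2f (b : ℕ) (x : ℝ) : ℝ :=
  1 / ((b : ℝ) + 1) -
    (b : ℝ) * ((b : ℝ) - 2) * ((sigma1 b x) ^ 2 - sigma2 b x) / 2 -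
    (b : ℝ) * ((b : ℝ) - 1) * (1 / ((b : ℝ) - 1) - sigma1 b x) * sigma1 b x

/-- `a_1(x)`: the position of the first nonzero base-`b` digit of `x` (junk value for `x = 0`). -/
def firstIdx (b : ℕ) (x : ℝ) : ℕ := sInf {i | xdigit b x i ≠ 0}

/-- `s̃_2(x) = b^{-1} - 2 b^{-a_1} - b^{-(a_1+1)} - (a_1 b - a_1 - b) σ(x)` for `x ≠ 0`,
and `s̃_2(0) = b^{-1}`. -/
def s2til (b : ℕ) (x : ℝ) : ℝ :=
  if x = 0 then (b : ℝ)⁻¹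
  else
    (b : ℝ)⁻¹ - 2 * ((b : ℝ) ^ firstIdx b x)⁻¹ - ((b : ℝ) ^ (firstIdx b x + 1))⁻¹ -
      ((firstIdx b x : ℝ) * b - (firstIdx b x : ℝ) - b) * sigma1 b x

/-! ### Digits of natural numbers and the Walsh coefficients -/

theorem mem_nzset {b k i : ℕ} (hb : 2 ≤ b) : i ∈ nzset b k ↔ ndigit b k i ≠ 0 := by
  simp only [nzset, Finset.mem_filter, Finset.mem_range, and_iff_right_iff_imp]
  intro h
  by_contra hi
  apply h
  have : k < b ^ i := lt_of_lt_of_le (Nat.lt_pow_self (by omega : 1 < b))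
    (Nat.pow_le_pow_right (by omega) (by omega))
  simp [ndigit, Nat.div_eq_of_lt this]

theorem lt_of_mem_nzset {b k n i : ℕ} (hb : 2 ≤ b) (hk : k < b ^ n) (hi : i ∈ nzset b k) :
    i < n := by
  rw [mem_nzset hb] at hi
  by_contra h
  apply hi
  have : k < b ^ i := lt_of_lt_of_le hk (Nat.pow_le_pow_right (by omega) (by omega))
  simp [ndigit, Nat.div_eq_of_lt this]

theorem ndigit_add_self {b κ n k : ℕ} (hκ : κ < b) (hk : k < b ^ n) :
    ndigit b (κ * b ^ n + k) n = κ := by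
  have hpos : 0 < b ^ n := by omega
  rw [ndigit, Nat.add_comm, Nat.add_mul_div_right _ _ hpos, Nat.div_eq_of_lt hk, Nat.zero_add,
    Nat.mod_eq_of_lt hκ]

theorem ndigit_add_of_lt {b κ n k i : ℕ} (hb : 2 ≤ b) (hi : i < n) :
    ndigit b (κ * b ^ n + k) i = ndigit b k i := by
  obtain ⟨j, rfl⟩ := Nat.exists_eq_add_of_lt hi
  have hpos : 0 < b ^ i := by positivity
  rw [ndigit, ndigit, show κ * b ^ (i + j + 1) + k = k + κ * b ^ j * b * b ^ i by ring,
    Nat.add_mul_div_right _ _ hpos, Nat.add_mul_mod_self_right]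

theorem nzset_zero (b : ℕ) : nzset b 0 = ∅ := by
  simp [nzset, ndigit]

theorem nzset_add {b κ n k : ℕ} (hb : 2 ≤ b) (hκ : κ < b) (hκ0 : κ ≠ 0) (hk : k < b ^ n) :
    nzset b (κ * b ^ n + k) = insert n (nzset b k) := by
  have hlt : κ * b ^ n + k < b ^ (n + 1) := by
    have : (κ + 1) * b ^ n ≤ b * b ^ n := Nat.mul_le_mul_right _ (by omega)
    rw [pow_succ']
    linarith
  ext i
  rw [Finset.mem_insert]
  rcases lt_trichotomy i n with h | rfl | h
  · rw [mem_nzset hb, mem_nzset hb, ndigit_add_of_lt hb h]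
    simp [h.ne]
  · simp [mem_nzset hb, ndigit_add_self hκ hk, hκ0]
  · constructor
    · intro hi
      have := lt_of_mem_nzset hb hlt hi
      omega
    · rintro (hi | hi)
      · omega
      · have := lt_of_mem_nzset hb hk hi
        omega

theorem notMem_nzset {b n k : ℕ} (hb : 2 ≤ b) (hk : k < b ^ n) : n ∉ nzset b k :=
  fun h => (lt_of_mem_nzset hb hk h).false

theorem one_le_card_nzset_iff {b k : ℕ} (hb : 2 ≤ b) : 1 ≤ (nzset b k).card ↔ k ≠ 0 := by
  constructor
  · rintro h rfl
    simp [nzset_zero] at h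
  · intro hk
    rw [Nat.one_le_iff_ne_zero, Finset.card_ne_zero]
    have hlog : b ^ Nat.log b k ≤ k := Nat.pow_log_le_self b hk
    refine ⟨Nat.log b k, (mem_nzset hb).2 ?_⟩
    have hlt : k < b ^ Nat.log b k * b := by
      rw [← pow_succ]
      exact Nat.lt_pow_succ_log_self (by omega) k
    rw [ndigit, Nat.mod_eq_of_lt (Nat.div_lt_of_lt_mul hlt)]
    exact (Nat.div_pos hlog (by positivity)).ne'

theorem ralpha_zero_left (b k : ℕ) : ralpha b 0 k = 1 := by
  simp [ralpha, topPos]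

theorem ralpha_zero_right (b α : ℕ) : ralpha b α 0 = 1 := by
  simp [ralpha, topPos, nzset_zero]

theorem ralpha_nonneg (b α k : ℕ) : 0 ≤ ralpha b α k := by
  unfold ralpha
  positivity

theorem topPos_succ_add {b κ n k : ℕ} (α : ℕ) (hb : 2 ≤ b) (hκ : κ < b) (hκ0 : κ ≠ 0)
    (hk : k < b ^ n) : topPos b (α + 1) (κ * b ^ n + k) = insert n (topPos b α k) := by
  have hn := notMem_nzset hb hk
  rw [topPos, nzset_add hb hκ hκ0 hk, Finset.filter_insert, if_pos]
  · rw [topPos]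
    congr 1
    apply Finset.filter_congr
    intro i hi
    have hin := lt_of_mem_nzset hb hk hi
    rw [Finset.filter_insert, if_pos hin, Finset.card_insert_of_notMem (by simp [hn])]
    omega
  · rw [Finset.filter_insert, if_neg (lt_irrefl n), Finset.filter_false_of_mem]
    · simp
    · intro i hi
      have := lt_of_mem_nzset hb hk hi
      omega

theorem ralpha_succ_add {b κ n k : ℕ} (α : ℕ) (hb : 2 ≤ b) (hκ : κ < b) (hκ0 : κ ≠ 0)
    (hk : k < b ^ n) :
    ralpha b (α + 1) (κ * b ^ n + k) = ((b : ℝ) ^ (n + 1))⁻¹ * ralpha b α k := by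
  rw [ralpha, topPos_succ_add α hb hκ hκ0 hk, Finset.sum_insert, pow_add, mul_inv, ralpha]
  intro h
  exact notMem_nzset hb hk (Finset.mem_filter.1 h).1

/-! ### Walsh functions -/

theorem wal_eq_sum_nzset (b k : ℕ) (x : ℝ) :
    wal b k x = Complex.exp (2 * (Real.pi : ℂ) * Complex.I / (b : ℂ) *
      ∑ i ∈ nzset b k, (ndigit b k i : ℂ) * (xdigit b x (i + 1) : ℂ)) := by
  rw [wal, nzset, Finset.sum_filter_of_ne]
  intro i _ h h0
  simp [h0] at h

theorem wal_zero_left (b : ℕ) (x : ℝ) : wal b 0 x = 1 := by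
  simp [wal, ndigit]

theorem wal_zero_right (b k : ℕ) : wal b k 0 = 1 := by
  simp [wal, xdigit]

theorem norm_wal (b k : ℕ) (x : ℝ) : ‖wal b k x‖ = 1 := by
  rw [wal, show 2 * (Real.pi : ℂ) * Complex.I / (b : ℂ) *
      ∑ i ∈ Finset.range (k + 1), (ndigit b k i : ℂ) * (xdigit b x (i + 1) : ℂ) =
      ((2 * Real.pi / b * ∑ i ∈ Finset.range (k + 1),
        (ndigit b k i : ℝ) * (xdigit b x (i + 1) : ℝ) : ℝ) : ℂ) * Complex.I by
    push_cast
    ring]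
  exact Complex.norm_exp_ofReal_mul_I _

theorem wal_add {b κ n k : ℕ} (x : ℝ) (hb : 2 ≤ b) (hκ : κ < b) (hκ0 : κ ≠ 0)
    (hk : k < b ^ n) :
    wal b (κ * b ^ n + k) x =
      Complex.exp (2 * (Real.pi : ℂ) * Complex.I / (b : ℂ)) ^ (xdigit b x (n + 1) * κ) *
        wal b k x := by
  have hsum : ∑ i ∈ nzset b k, (ndigit b (κ * b ^ n + k) i : ℂ) * (xdigit b x (i + 1) : ℂ) =
      ∑ i ∈ nzset b k, (ndigit b k i : ℂ) * (xdigit b x (i + 1) : ℂ) :=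
    Finset.sum_congr rfl fun i hi => by
      rw [ndigit_add_of_lt hb (lt_of_mem_nzset hb hk hi)]
  rw [wal_eq_sum_nzset, wal_eq_sum_nzset, nzset_add hb hκ hκ0 hk,
    Finset.sum_insert (notMem_nzset hb hk), hsum, ndigit_add_self hκ hk, mul_add, Complex.exp_add,
    ← Complex.exp_nat_mul]
  push_cast
  ring_nf

theorem xdigit_lt {b : ℕ} (hb : 2 ≤ b) (x : ℝ) (i : ℕ) : xdigit b x i < b :=
  Nat.mod_lt _ (by omega)

/-- The sum of `exp(2πi ξ κ / b)` over `1 ≤ κ < b`, where `ξ` is the digit of `x` in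
position `n + 1`. -/
def digitSum (b : ℕ) (x : ℝ) (n : ℕ) : ℝ :=
  (b : ℝ) - 1 - b * if xdigit b x (n + 1) ≠ 0 then 1 else 0

theorem sum_exp_pow_eq_digitSum {b : ℕ} (hb : 2 ≤ b) (x : ℝ) (n : ℕ) :
    ∑ κ ∈ Finset.Ico 1 b,
      Complex.exp (2 * (Real.pi : ℂ) * Complex.I / (b : ℂ)) ^ (xdigit b x (n + 1) * κ) =
      (digitSum b x n : ℂ) := by
  have hprim := Complex.isPrimitiveRoot_exp b (by omega)
  have hlt := xdigit_lt hb x (n + 1)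
  have hsplit := Finset.sum_range_add_sum_Ico (fun κ =>
    Complex.exp (2 * (Real.pi : ℂ) * Complex.I / (b : ℂ)) ^ (xdigit b x (n + 1) * κ))
    (show 1 ≤ b by omega)
  rw [Finset.sum_range_one, mul_zero, pow_zero] at hsplit
  rw [eq_sub_of_add_eq' hsplit, digitSum]
  by_cases h : xdigit b x (n + 1) = 0
  · simp [h]
  · have hne := hprim.pow_ne_one_of_pos_of_lt h hlt
    simp_rw [pow_mul]
    rw [geom_sum_eq hne, ← pow_mul, mul_comm (xdigit b x (n + 1)) b, pow_mul, hprim.pow_eq_one]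
    simp [h]

/-! ### Sums over blocks `k < b ^ n` -/

theorem sum_range_pow_succ {M : Type*} [AddCommMonoid M] {b : ℕ} (hb : 2 ≤ b) (n : ℕ)
    (f : ℕ → M) :
    ∑ k ∈ Finset.range (b ^ (n + 1)), f k = ∑ k ∈ Finset.range (b ^ n), f k +
      ∑ κ ∈ Finset.Ico 1 b, ∑ k ∈ Finset.range (b ^ n), f (κ * b ^ n + k) := by
  have hmul (m : ℕ) : ∑ k ∈ Finset.range (m * b ^ n), f k =
      ∑ κ ∈ Finset.range m, ∑ k ∈ Finset.range (b ^ n), f (κ * b ^ n + k) := by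
    induction m with
    | zero => simp
    | succ m ih => rw [Nat.succ_mul, Finset.sum_range_add, ih, Finset.sum_range_succ]
  rw [pow_succ', hmul, ← Finset.sum_range_add_sum_Ico _ (show 1 ≤ b by omega)]
  simp

/-- If every value of `f` on the block `κ b ^ n + k`, `k < b ^ n`, is `c` times the value of `g`
at `k` times the Walsh value at `κ b ^ n`, then the sum of `f` over `k < b ^ (n + 1)` is obtained
from the one over `k < b ^ n` by adding a multiple of the sum of `g`. -/
theorem sum_range_pow_succ_of_factor {b : ℕ} (hb : 2 ≤ b) (x : ℝ) (n : ℕ) (f g : ℕ → ℂ) (c : ℂ)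
    (h : ∀ κ k, κ < b → κ ≠ 0 → k < b ^ n → f (κ * b ^ n + k) = c *
      Complex.exp (2 * (Real.pi : ℂ) * Complex.I / (b : ℂ)) ^ (xdigit b x (n + 1) * κ) * g k) :
    ∑ k ∈ Finset.range (b ^ (n + 1)), f k = ∑ k ∈ Finset.range (b ^ n), f k +
      c * digitSum b x n * ∑ k ∈ Finset.range (b ^ n), g k := by
  rw [sum_range_pow_succ hb, ← sum_exp_pow_eq_digitSum hb, mul_assoc, Finset.sum_mul,
    Finset.mul_sum]
  congr 1
  refine Finset.sum_congr rfl fun κ hκ => ?_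
  rw [Finset.mem_Ico] at hκ
  rw [← mul_assoc, Finset.mul_sum]
  exact Finset.sum_congr rfl fun k hk =>
    h κ k hκ.2 (by omega) (Finset.mem_range.1 hk)

/-- The sum of `r_α(k) wal_k(x)` over `k < b ^ n`. -/
def walSum (b α : ℕ) (x : ℝ) (n : ℕ) : ℂ :=
  ∑ k ∈ Finset.range (b ^ n), (ralpha b α k : ℂ) * wal b k x

/-- The sum of `r_2(k) wal_k(x)` over the `k < b ^ n` with at least two nonzero digits. -/
def walSumTwo (b : ℕ) (x : ℝ) (n : ℕ) : ℂ :=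
  ∑ k ∈ Finset.range (b ^ n),
    if 2 ≤ (nzset b k).card then (ralpha b 2 k : ℂ) * wal b k x else 0

theorem walSum_zero_right (b α : ℕ) (x : ℝ) : walSum b α x 0 = 1 := by
  simp [walSum, ralpha_zero_right, wal_zero_left]

theorem walSumTwo_zero_right (b : ℕ) (x : ℝ) : walSumTwo b x 0 = 0 := by
  simp [walSumTwo, nzset_zero]

theorem walSum_zero_succ {b : ℕ} (hb : 2 ≤ b) (x : ℝ) (n : ℕ) :
    walSum b 0 x (n + 1) = walSum b 0 x n + digitSum b x n * walSum b 0 x n := by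
  rw [walSum, sum_range_pow_succ_of_factor hb x n _ (fun k => (ralpha b 0 k : ℂ) * wal b k x) 1,
    one_mul]
  · rfl
  · intro κ k hκ hκ0 hk
    rw [wal_add x hb hκ hκ0 hk, ralpha_zero_left, ralpha_zero_left]
    push_cast
    ring

theorem walSum_succ_succ {b : ℕ} (hb : 2 ≤ b) (α : ℕ) (x : ℝ) (n : ℕ) :
    walSum b (α + 1) x (n + 1) = walSum b (α + 1) x n +
      ((b : ℂ) ^ (n + 1))⁻¹ * digitSum b x n * walSum b α x n := by
  rw [walSum, sum_range_pow_succ_of_factor hb x n _ (fun k => (ralpha b α k : ℂ) * wal b k x)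
    ((b : ℂ) ^ (n + 1))⁻¹]
  · rfl
  · intro κ k hκ hκ0 hk
    rw [wal_add x hb hκ hκ0 hk, ralpha_succ_add α hb hκ hκ0 hk]
    push_cast
    ring

theorem walSumTwo_succ {b : ℕ} (hb : 2 ≤ b) (x : ℝ) (n : ℕ) :
    walSumTwo b x (n + 1) = walSumTwo b x n +
      ((b : ℂ) ^ (n + 1))⁻¹ * digitSum b x n * (walSum b 1 x n - 1) := by
  have hsub : walSum b 1 x n - 1 = ∑ k ∈ Finset.range (b ^ n),
      if k ≠ 0 then (ralpha b 1 k : ℂ) * wal b k x else 0 := by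
    obtain ⟨m, hm⟩ : ∃ m, b ^ n = m + 1 :=
      Nat.exists_eq_succ_of_ne_zero (pow_ne_zero _ (by omega))
    rw [walSum, hm, Finset.sum_range_succ', Finset.sum_range_succ']
    simp [ralpha_zero_right, wal_zero_left]
  rw [hsub, walSumTwo, sum_range_pow_succ_of_factor hb x n _
    (fun k => if k ≠ 0 then (ralpha b 1 k : ℂ) * wal b k x else 0) ((b : ℂ) ^ (n + 1))⁻¹]
  · rfl
  · intro κ k hκ hκ0 hk
    have hiff : 2 ≤ (nzset b (κ * b ^ n + k)).card ↔ k ≠ 0 := by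
      rw [nzset_add hb hκ hκ0 hk, Finset.card_insert_of_notMem (notMem_nzset hb hk),
        ← one_le_card_nzset_iff hb]
      omega
    by_cases hk0 : k = 0
    · rw [if_neg (by rw [hiff]; simpa using hk0), if_neg (by simpa using hk0), mul_zero]
    · rw [if_pos (hiff.2 hk0), if_pos hk0, wal_add x hb hκ hκ0 hk,
        ralpha_succ_add 1 hb hκ hκ0 hk]
      push_cast
      ring

/-- The partial sums of `sigma1`. -/
def sigmaPartial (b : ℕ) (x : ℝ) (n : ℕ) : ℝ :=
  ∑ i ∈ Finset.range n, if xdigit b x (i + 1) ≠ 0 then ((b : ℝ) ^ (i + 1))⁻¹ else 0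

theorem sigmaPartial_succ (b : ℕ) (x : ℝ) (n : ℕ) :
    sigmaPartial b x (n + 1) = sigmaPartial b x n +
      ((b : ℝ) ^ (n + 1))⁻¹ * if xdigit b x (n + 1) ≠ 0 then 1 else 0 := by
  rw [sigmaPartial, Finset.sum_range_succ, sigmaPartial]
  simp

theorem walSum_two_eq {b : ℕ} (hb : 2 ≤ b) (x : ℝ) (n : ℕ) :
    walSum b 2 x n = walSumTwo b x n +
      ((2 - ((b : ℝ) ^ n)⁻¹ - b * sigmaPartial b x n : ℝ) : ℂ) := by
  have hb0 : (b : ℂ) ≠ 0 := by exact_mod_cast (by omega : b ≠ 0)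
  induction n with
  | zero =>
    rw [walSum_zero_right, walSumTwo_zero_right, sigmaPartial]
    norm_num
  | succ n ih =>
    rw [walSum_succ_succ hb 1, walSumTwo_succ hb, ih, sigmaPartial_succ, digitSum]
    generalize (if xdigit b x (n + 1) ≠ 0 then (1 : ℝ) else 0) = e
    push_cast
    field_simp
    ring

section LeadingZeros

variable {b : ℕ} {x : ℝ} {n : ℕ}

theorem digitSum_of_eq_zero (h : xdigit b x (n + 1) = 0) : digitSum b x n = b - 1 := by
  simp [digitSum, h]

theorem digitSum_of_ne_zero (h : xdigit b x (n + 1) ≠ 0) : digitSum b x n = -1 := by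
  simp [digitSum, h]

theorem walSum_zero_of_leading_zeros (hb : 2 ≤ b) (h : ∀ i < n, xdigit b x (i + 1) = 0) :
    walSum b 0 x n = (b : ℂ) ^ n := by
  induction n with
  | zero => rw [walSum_zero_right, pow_zero]
  | succ n ih =>
    rw [walSum_zero_succ hb, ih fun i hi => h i (by omega),
      digitSum_of_eq_zero (h n (by omega))]
    push_cast
    ring

theorem walSum_one_of_leading_zeros (hb : 2 ≤ b) (h : ∀ i < n, xdigit b x (i + 1) = 0) :
    walSum b 1 x n = 1 + n * ((b : ℂ) - 1) / b := by
  have hb0 : (b : ℂ) ≠ 0 := by exact_mod_cast (by omega : b ≠ 0)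
  induction n with
  | zero => simp [walSum_zero_right]
  | succ n ih =>
    rw [walSum_succ_succ hb 0, walSum_zero_of_leading_zeros hb fun i hi => h i (by omega),
      ih fun i hi => h i (by omega), digitSum_of_eq_zero (h n (by omega))]
    push_cast
    field_simp
    ring

theorem walSumTwo_of_leading_zeros (hb : 2 ≤ b) (h : ∀ i < n, xdigit b x (i + 1) = 0) :
    walSumTwo b x n =
      (((b : ℝ)⁻¹ - ((b : ℝ) ^ n)⁻¹ * (n * ((b : ℝ) - 1) + 1) / b : ℝ) : ℂ) := by
  have hb0 : (b : ℂ) ≠ 0 := by exact_mod_cast (by omega : b ≠ 0)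
  induction n with
  | zero => simp [walSumTwo_zero_right]
  | succ n ih =>
    rw [walSumTwo_succ hb, walSum_one_of_leading_zeros hb fun i hi => h i (by omega),
      ih fun i hi => h i (by omega), digitSum_of_eq_zero (h n (by omega))]
    push_cast
    field_simp
    ring

theorem sigmaPartial_of_leading_zeros (h : ∀ i < n, xdigit b x (i + 1) = 0) :
    sigmaPartial b x n = 0 :=
  Finset.sum_eq_zero fun i hi => by simp [h i (Finset.mem_range.1 hi)]

end LeadingZeros

section FirstNonzeroDigit

variable {b : ℕ} {x : ℝ} {p : ℕ}

theorem walSum_zero_of_first_digit (hb : 2 ≤ b) (hp : xdigit b x (p + 1) ≠ 0) (m : ℕ) :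
    walSum b 0 x (p + 1 + m) = 0 := by
  induction m with
  | zero =>
    rw [add_zero, walSum_zero_succ hb, digitSum_of_ne_zero hp]
    push_cast
    ring
  | succ m ih => rw [← add_assoc, walSum_zero_succ hb, ih, mul_zero, add_zero]

theorem walSum_one_of_first_digit (hb : 2 ≤ b) (h : ∀ i < p, xdigit b x (i + 1) = 0)
    (hp : xdigit b x (p + 1) ≠ 0) (m : ℕ) :
    walSum b 1 x (p + 1 + m) = 1 + (p * ((b : ℂ) - 1) - 1) / b := by
  have hb0 : (b : ℂ) ≠ 0 := by exact_mod_cast (by omega : b ≠ 0)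
  induction m with
  | zero =>
    rw [add_zero, walSum_succ_succ hb 0, walSum_zero_of_leading_zeros hb h,
      walSum_one_of_leading_zeros hb h, digitSum_of_ne_zero hp]
    push_cast
    field_simp
    ring
  | succ m ih =>
    rw [← add_assoc, walSum_succ_succ hb 0, ih, walSum_zero_of_first_digit hb hp, mul_zero,
      add_zero]

theorem walSumTwo_of_first_digit (hb : 2 ≤ b) (h : ∀ i < p, xdigit b x (i + 1) = 0)
    (hp : xdigit b x (p + 1) ≠ 0) (m : ℕ) :
    walSumTwo b x (p + 1 + m) =
      (((b : ℝ)⁻¹ - 2 * ((b : ℝ) ^ (p + 1))⁻¹ - ((b : ℝ) ^ (p + 2))⁻¹ -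
        (p * ((b : ℝ) - 1) - 1) * sigmaPartial b x (p + 1 + m) -
        ((b : ℝ) ^ (p + 1 + m))⁻¹ * ((p * ((b : ℝ) - 1) - 1) / b) : ℝ) : ℂ) := by
  have hb0 : (b : ℂ) ≠ 0 := by exact_mod_cast (by omega : b ≠ 0)
  induction m with
  | zero =>
    rw [add_zero, walSumTwo_succ hb, walSumTwo_of_leading_zeros hb h,
      walSum_one_of_leading_zeros hb h, digitSum_of_ne_zero hp, sigmaPartial_succ,
      sigmaPartial_of_leading_zeros h, if_pos hp]
    push_cast
    field_simp
    ring
  | succ m ih =>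
    rw [← add_assoc, walSumTwo_succ hb, ih, walSum_one_of_first_digit hb h hp, digitSum,
      sigmaPartial_succ]
    generalize (if xdigit b x (p + 1 + m + 1) ≠ 0 then (1 : ℝ) else 0) = e
    push_cast
    field_simp
    ring

end FirstNonzeroDigit

/-! ### Digits of real numbers -/

theorem xdigit_zero_right {b : ℕ} {x : ℝ} (hx0 : 0 ≤ x) (hx1 : x < 1) : xdigit b x 0 = 0 := by
  have : ⌊x⌋ = 0 := Int.floor_eq_zero_iff.2 ⟨hx0, hx1⟩
  simp [xdigit, this]

theorem exists_xdigit_ne_zero {b : ℕ} (hb : 2 ≤ b) {x : ℝ} (hx0 : 0 < x) (hx1 : x < 1) :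
    ∃ i, xdigit b x i ≠ 0 := by
  have hb1 : (1 : ℝ) < b := by exact_mod_cast (by omega : 1 < b)
  have hex : ∃ i : ℕ, 1 ≤ x * (b : ℝ) ^ i := by
    obtain ⟨i, hi⟩ := pow_unbounded_of_one_lt x⁻¹ hb1
    exact ⟨i, by rw [inv_lt_iff_one_lt_mul₀ hx0] at hi; linarith⟩
  obtain ⟨i, hi, hmin⟩ : ∃ i : ℕ, 1 ≤ x * (b : ℝ) ^ i ∧ ∀ j < i, x * (b : ℝ) ^ j < 1 :=
    ⟨Nat.find hex, Nat.find_spec hex, fun j hj => not_le.1 (Nat.find_min hex hj)⟩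
  refine ⟨i, ?_⟩
  obtain _ | j := i
  · simp at hi
    linarith
  have hj := hmin j (by omega)
  have hlt : x * (b : ℝ) ^ (j + 1) < b := by
    rw [pow_succ, ← mul_assoc]
    exact mul_lt_of_lt_one_left (by linarith) hj
  have h1 : 1 ≤ ⌊x * (b : ℝ) ^ (j + 1)⌋ := Int.le_floor.2 (by exact_mod_cast hi)
  have h2 : ⌊x * (b : ℝ) ^ (j + 1)⌋ < b := Int.floor_lt.2 (by exact_mod_cast hlt)
  rw [xdigit, Nat.mod_eq_of_lt (by omega)]
  omega

theorem firstIdx_spec {b : ℕ} (hb : 2 ≤ b) {x : ℝ} (hx0 : 0 < x) (hx1 : x < 1) :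
    ∃ p, firstIdx b x = p + 1 ∧ xdigit b x (p + 1) ≠ 0 ∧ ∀ i < p, xdigit b x (i + 1) = 0 := by
  have hmem : xdigit b x (firstIdx b x) ≠ 0 := Nat.sInf_mem (exists_xdigit_ne_zero hb hx0 hx1)
  obtain ⟨p, hp⟩ : ∃ p, firstIdx b x = p + 1 := Nat.exists_eq_succ_of_ne_zero fun h => by
    rw [h, xdigit_zero_right hx0.le hx1] at hmem
    exact hmem rfl
  refine ⟨p, hp, hp ▸ hmem, fun i hi => ?_⟩
  by_contra h
  have : firstIdx b x ≤ i + 1 := Nat.sInf_le h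
  omega

/-! ### Limits -/

theorem tendsto_inv_pow_nat {b : ℕ} (hb : 2 ≤ b) :
    Filter.Tendsto (fun n : ℕ => ((b : ℝ) ^ n)⁻¹) Filter.atTop (nhds 0) := by
  have hb1 : (1 : ℝ) < b := by exact_mod_cast (by omega : 1 < b)
  simpa only [inv_pow] using
    tendsto_pow_atTop_nhds_zero_of_lt_one (by positivity) (inv_lt_one_of_one_lt₀ hb1)

theorem tendsto_sigmaPartial {b : ℕ} (hb : 2 ≤ b) (x : ℝ) :
    Filter.Tendsto (sigmaPartial b x) Filter.atTop (nhds (sigma1 b x)) := by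
  have hb1 : (1 : ℝ) < b := by exact_mod_cast (by omega : 1 < b)
  refine (Summable.hasSum ?_).tendsto_sum_nat
  refine Summable.of_nonneg_of_le (fun i => ?_) (fun i => ?_)
    ((summable_nat_add_iff 1).2 (summable_geometric_of_lt_one (by positivity : 0 ≤ (b : ℝ)⁻¹)
      (inv_lt_one_of_one_lt₀ hb1)))
  · split_ifs <;> positivity
  · rw [inv_pow]
    split_ifs
    · exact le_rfl
    · positivity

theorem tendsto_walSumTwo {b : ℕ} (hb : 2 ≤ b) {x : ℝ} (hx0 : 0 ≤ x) (hx1 : x < 1) :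
    Filter.Tendsto (walSumTwo b x) Filter.atTop (nhds ((s2til b x : ℝ) : ℂ)) := by
  have hb1 : (1 : ℝ) < b := by exact_mod_cast (by omega : 1 < b)
  have hgeom := tendsto_inv_pow_nat hb
  rcases hx0.eq_or_lt with rfl | hx
  · have heq : walSumTwo b 0 = fun n : ℕ =>
        (((b : ℝ)⁻¹ - ((b : ℝ) ^ n)⁻¹ * (n * ((b : ℝ) - 1) + 1) / b : ℝ) : ℂ) :=
      funext fun n => walSumTwo_of_leading_zeros hb fun i _ => by simp [xdigit]
    rw [heq, s2til, if_pos rfl]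
    apply (Complex.continuous_ofReal.tendsto _).comp
    have hn : Filter.Tendsto (fun n : ℕ => (n : ℝ) * ((b : ℝ) ^ n)⁻¹) Filter.atTop (nhds 0) := by
      simpa only [inv_pow] using tendsto_self_mul_const_pow_of_lt_one
        (by positivity : 0 ≤ (b : ℝ)⁻¹) (inv_lt_one_of_one_lt₀ hb1)
    have hlim := ((hn.mul_const (((b : ℝ) - 1) / b)).add (hgeom.mul_const (b : ℝ)⁻¹)).const_sub
      (b : ℝ)⁻¹
    rw [zero_mul, zero_mul, add_zero, sub_zero] at hlim
    refine hlim.congr fun n => ?_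
    ring
  · obtain ⟨p, hfirst, hp, h⟩ := firstIdx_spec hb hx hx1
    rw [s2til, if_neg hx.ne', hfirst]
    have hshift : Filter.Tendsto (fun m : ℕ => p + 1 + m) Filter.atTop Filter.atTop :=
      Filter.tendsto_atTop_mono (fun m => Nat.le_add_left m (p + 1)) Filter.tendsto_id
    rw [← Filter.tendsto_add_atTop_iff_nat (p + 1)]
    simp_rw [add_comm _ (p + 1), walSumTwo_of_first_digit hb h hp]
    apply (Complex.continuous_ofReal.tendsto _).comp
    have hlim := ((((tendsto_sigmaPartial hb x).comp hshift).const_mul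
      (p * ((b : ℝ) - 1) - 1)).const_sub
        ((b : ℝ)⁻¹ - 2 * ((b : ℝ) ^ (p + 1))⁻¹ - ((b : ℝ) ^ (p + 2))⁻¹)).sub
      ((hgeom.comp hshift).mul_const ((p * ((b : ℝ) - 1) - 1) / b))
    convert hlim using 2
    · simp only [Function.comp_apply]
    · push_cast
      ring

theorem tendsto_walSum_two {b : ℕ} (hb : 2 ≤ b) {x : ℝ} (hx0 : 0 ≤ x) (hx1 : x < 1) :
    Filter.Tendsto (walSum b 2 x) Filter.atTop
      (nhds ((1 + (s1f b x + s2til b x) : ℝ) : ℂ)) := by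
  have hlim := (tendsto_walSumTwo hb hx0 hx1).add ((Complex.continuous_ofReal.tendsto _).comp
    (((tendsto_inv_pow_nat hb).const_sub 2).sub ((tendsto_sigmaPartial hb x).const_mul (b : ℝ))))
  have hval : ((1 + (s1f b x + s2til b x) : ℝ) : ℂ) =
      (s2til b x : ℂ) + ((2 - 0 - b * sigma1 b x : ℝ) : ℂ) := by
    rw [s1f]
    push_cast
    ring
  rw [funext (walSum_two_eq hb x), hval]
  exact hlim

theorem summable_ralpha_two {b : ℕ} (hb : 2 ≤ b) : Summable (ralpha b 2) := by
  have hb1 : (1 : ℝ) < b := by exact_mod_cast (by omega : 1 < b)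
  refine summable_of_sum_range_le (c := (b : ℝ)⁻¹ + 2) (ralpha_nonneg b 2) fun n => ?_
  have hle : ∑ k ∈ Finset.range n, ralpha b 2 k ≤ ∑ k ∈ Finset.range (b ^ n), ralpha b 2 k :=
    Finset.sum_le_sum_of_subset_of_nonneg
      (Finset.range_subset_range.2 (Nat.lt_pow_self (by omega : 1 < b)).le)
      fun k _ _ => ralpha_nonneg b 2 k
  refine hle.trans ?_
  have hzero : ∀ i < n, xdigit b 0 (i + 1) = 0 := fun i _ => by simp [xdigit]
  have heq : ((∑ k ∈ Finset.range (b ^ n), ralpha b 2 k : ℝ) : ℂ) = walSum b 2 0 n := by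
    simp [walSum, wal_zero_right]
  rw [walSum_two_eq hb, walSumTwo_of_leading_zeros hb hzero,
    sigmaPartial_of_leading_zeros hzero, ← Complex.ofReal_add, Complex.ofReal_inj] at heq
  rw [heq]
  have h1 : 0 ≤ ((b : ℝ) ^ n)⁻¹ * (n * ((b : ℝ) - 1) + 1) / b := by
    have : 0 ≤ (b : ℝ) - 1 := by linarith
    positivity
  have h2 : 0 ≤ ((b : ℝ) ^ n)⁻¹ := by positivity
  linarith

theorem hasSum_of_tendsto_sum_range_pow {b : ℕ} (hb : 2 ≤ b) {f : ℕ → ℂ} (hf : Summable f)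
    {l : ℂ} (h : Filter.Tendsto (fun n : ℕ => ∑ k ∈ Finset.range (b ^ n), f k) Filter.atTop
      (nhds l)) : HasSum f l := by
  have hpow : Filter.Tendsto (fun n : ℕ => b ^ n) Filter.atTop Filter.atTop :=
    tendsto_pow_atTop_atTop_of_one_lt (by omega)
  rw [tendsto_nhds_unique h (hf.hasSum.tendsto_sum_nat.comp hpow)]
  exact hf.hasSum

theorem norm_ralpha_mul_wal (b α k : ℕ) (x : ℝ) :
    ‖(ralpha b α k : ℂ) * wal b k x‖ = ralpha b α k := by
  rw [norm_mul, norm_wal, mul_one, Complex.norm_real, Real.norm_of_nonneg (ralpha_nonneg b α k)]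

/-- `ω_2(x) = s_1(x) + s̃_2(x)`, and `s̃_2(x)` is the (absolutely convergent) sum of
`r_2(k) wal_k(x)` over all `k ≥ 1` with at least two nonzero base-`b` digits. -/
theorem stmt10 (b : ℕ) (hb : 2 ≤ b) (x : ℝ) (hx0 : 0 ≤ x) (hx1 : x < 1) :
    omegaF b 2 x = ((s1f b x + s2til b x : ℝ) : ℂ) ∧
    HasSum
      (fun k : ℕ => if 2 ≤ (nzset b k).card then (ralpha b 2 k : ℂ) * wal b k x else 0)
      ((s2til b x : ℝ) : ℂ) := by
  have hsum := summable_ralpha_two hb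
  constructor
  · have hall : HasSum (fun k => (ralpha b 2 k : ℂ) * wal b k x) _ :=
      hasSum_of_tendsto_sum_range_pow hb
        (Summable.of_norm (by simpa only [norm_ralpha_mul_wal] using hsum))
        (tendsto_walSum_two hb hx0 hx1)
    rw [← hasSum_nat_add_iff' 1] at hall
    rw [omegaF, hall.tsum_eq, Finset.sum_range_one, ralpha_zero_right, wal_zero_left]
    push_cast
    ring
  · refine hasSum_of_tendsto_sum_range_pow hb ?_ (tendsto_walSumTwo hb hx0 hx1)
    refine Summable.of_norm_bounded hsum fun k => ?_
    split_ifs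
    · exact (norm_ralpha_mul_wal b 2 k x).le
    · simpa using ralpha_nonneg b 2 k
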